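/- For every Schwartz function ψ : ℝ → ℂ, the Hilbert transform (Hψ)(x) = (1/π) lim_{ε → 0⁺} ∫_{|y| ≥ ε} ψ(x − y)/y dy is well-defined for every x ∈ ℝ, and for every 1 < p < ∞ there exists a constant A_p, independent of ψ, such that ‖Hψ‖_{L^p(ℝ)} ≤ A_p ‖ψ‖_{L^p(ℝ)}. -/

import Mathlib

open MeasureTheory Filter Topology

/-- On the right half-plane, `‖z‖ ^ p` is controlled by `(re z) ^ p` up to a multiple of the real
part of the holomorphic function `z ^ p`. -/
lemma exists_rpow_norm_le_re_cpow {p : ℝ} (hp : 1 < p) (hp2 : p ≤ 2) :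
    ∃ A B : ℝ, 0 ≤ A ∧ 0 ≤ B ∧ ∀ z : ℂ, 0 < z.re →
      ‖z‖ ^ p ≤ A * z.re ^ p - B * (z ^ (p : ℂ)).re := by
  have hπ := Real.pi_pos
  set θ₀ : ℝ := (Real.pi / (2 * p) + Real.pi / 2) / 2 with hθ₀
  have hlt : Real.pi / (2 * p) < Real.pi / 2 := by
    apply div_lt_div_of_pos_left hπ (by norm_num); linarith
  have hpos : 0 < Real.pi / (2 * p) := by positivity
  have h1 : θ₀ < Real.pi / 2 := by linarith
  have h0 : 0 < θ₀ := by linarith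
  have h2 : Real.pi / 2 < p * θ₀ := by
    have : p * (Real.pi / (2 * p)) = Real.pi / 2 := by field_simp
    nlinarith
  have h3 : p * θ₀ < Real.pi := by nlinarith
  have hc0 : Real.cos (p * θ₀) < 0 :=
    Real.cos_neg_of_pi_div_two_lt_of_lt h2 (by linarith)
  have hcθ : 0 < Real.cos θ₀ := Real.cos_pos_of_mem_Ioo ⟨by linarith, h1⟩
  set c := -Real.cos (p * θ₀) with hc
  have hcpos : 0 < c := by linarith
  refine ⟨(1 + 1 / c) / Real.cos θ₀ ^ p, 1 / c, by positivity, by positivity, fun z hz => ?_⟩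
  have hz0 : z ≠ 0 := by rintro rfl; simp at hz
  have hn : 0 < ‖z‖ := norm_pos_iff.2 hz0
  have harg : |z.arg| < Real.pi / 2 := Complex.abs_arg_lt_pi_div_two_iff.2 (Or.inl hz)
  have hcos : 0 < Real.cos |z.arg| :=
    Real.cos_pos_of_mem_Ioo ⟨by linarith [abs_nonneg z.arg], harg⟩
  have hre : z.re = ‖z‖ * Real.cos |z.arg| := by
    rw [Real.cos_abs]; exact (Complex.norm_mul_cos_arg z).symm
  have hrep : (z ^ (p : ℂ)).re = ‖z‖ ^ p * Real.cos (p * |z.arg|) := by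
    rw [Complex.cpow_ofReal_re]
    congr 1
    rw [← Real.cos_abs, abs_mul, mul_comm, abs_of_pos (by linarith : (0:ℝ) < p)]
  rw [hrep, hre, Real.mul_rpow hn.le hcos.le]
  have key : 1 ≤ (1 + 1 / c) / Real.cos θ₀ ^ p * Real.cos |z.arg| ^ p
      - 1 / c * Real.cos (p * |z.arg|) := by
    rcases le_total |z.arg| θ₀ with h | h
    · have h4 : Real.cos θ₀ ≤ Real.cos |z.arg| :=
        Real.cos_le_cos_of_nonneg_of_le_pi (abs_nonneg _) (by linarith) h
      have h5 : Real.cos θ₀ ^ p ≤ Real.cos |z.arg| ^ p :=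
        Real.rpow_le_rpow hcθ.le h4 (by linarith)
      have h6 : 1 + 1 / c ≤ (1 + 1 / c) / Real.cos θ₀ ^ p * Real.cos |z.arg| ^ p := by
        rw [div_mul_eq_mul_div, le_div_iff₀ (by positivity)]
        gcongr
      have h7 : 1 / c * Real.cos (p * |z.arg|) ≤ 1 / c * 1 := by
        gcongr; exact Real.cos_le_one _
      linarith
    · have h4 : Real.cos (p * |z.arg|) ≤ Real.cos (p * θ₀) :=
        Real.cos_le_cos_of_nonneg_of_le_pi (by positivity)
          (by nlinarith [abs_nonneg z.arg]) (by gcongr)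
      have h5 : 0 ≤ (1 + 1 / c) / Real.cos θ₀ ^ p * Real.cos |z.arg| ^ p := by positivity
      have h6 : 1 / c * Real.cos (p * |z.arg|) ≤ 1 / c * (-c) := by
        gcongr; linarith
      have h7 : 1 / c * (-c) = -1 := by field_simp
      linarith
  calc ‖z‖ ^ p = ‖z‖ ^ p * 1 := by ring
    _ ≤ ‖z‖ ^ p * ((1 + 1 / c) / Real.cos θ₀ ^ p * Real.cos |z.arg| ^ p
      - 1 / c * Real.cos (p * |z.arg|)) := by gcongr
    _ = _ := by ring

/-- The Cauchy integral of `f`, normalised so that its real part is the Poisson integral. -/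
noncomputable def cauchyIntegral (f : ℝ → ℝ) (z : ℂ) : ℂ :=
  (Complex.I / Real.pi) * ∫ t, (f t : ℂ) / (z - t)

/-- The Poisson integral of `f` on the line at height `y`. -/
noncomputable def poissonIntegral (y : ℝ) (f : ℝ → ℝ) (x : ℝ) : ℝ :=
  Real.pi⁻¹ * ∫ t, y / ((x - t) ^ 2 + y ^ 2) * f t

/-- The conjugate Poisson integral of `f` on the line at height `y`. -/
noncomputable def conjPoissonIntegral {E : Type*} [NormedAddCommGroup E] [NormedSpace ℝ E]
    (y : ℝ) (f : ℝ → E) (x : ℝ) : E :=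
  Real.pi⁻¹ • ∫ t, ((x - t) / ((x - t) ^ 2 + y ^ 2)) • f t

lemma norm_div_sub_le {f : ℝ → ℝ} {z : ℂ} {δ : ℝ} (hδ : 0 < δ) (hz : δ ≤ z.im) (t : ℝ) :
    ‖(f t : ℂ) / (z - t)‖ ≤ ‖f t‖ / δ := by
  have h : δ ≤ ‖z - t‖ := by
    calc δ ≤ (z - t).im := by simpa
      _ ≤ ‖z - t‖ := (le_abs_self _).trans (Complex.abs_im_le_norm _)
  rw [norm_div, Complex.norm_real]
  gcongr

lemma integrable_div_sub {f : ℝ → ℝ} (hf : Integrable f) {z : ℂ} (hz : 0 < z.im) :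
    Integrable fun t : ℝ => (f t : ℂ) / (z - t) := by
  refine (hf.norm.div_const z.im).mono' ?_ (ae_of_all _ fun t => norm_div_sub_le hz le_rfl t)
  have : AEStronglyMeasurable (fun t => (f t : ℂ)) volume := hf.ofReal.aestronglyMeasurable
  refine this.div₀ ?_
  fun_prop

lemma differentiableAt_cauchyIntegral {f : ℝ → ℝ} (hf : Integrable f) {z : ℂ} (hz : 0 < z.im) :
    DifferentiableAt ℂ (cauchyIntegral f) z := by
  refine DifferentiableAt.const_mul ?_ _
  have hs : {w : ℂ | z.im / 2 < w.im} ∈ 𝓝 z :=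
    (isOpen_lt continuous_const Complex.continuous_im).mem_nhds (half_lt_self hz)
  have hm : AEStronglyMeasurable (fun t => (f t : ℂ)) volume := hf.ofReal.aestronglyMeasurable
  have key := hasDerivAt_integral_of_dominated_loc_of_deriv_le (μ := volume)
    (F := fun (w : ℂ) (t : ℝ) => (f t : ℂ) / (w - t))
    (F' := fun (w : ℂ) (t : ℝ) => -((f t : ℂ) / (w - t) ^ 2))
    (bound := fun t => ‖f t‖ / (z.im / 2) ^ 2) hs ?_ (integrable_div_sub hf hz) ?_ ?_ ?_ ?_
  · exact key.2.differentiableAt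
  · filter_upwards [hs] with w hw
    have hw : z.im / 2 < w.im := hw
    exact (integrable_div_sub hf (by linarith)).aestronglyMeasurable
  · exact (hm.div₀ (by fun_prop)).neg
  · refine ae_of_all _ fun t w hw => ?_
    have hw : z.im / 2 < w.im := hw
    have h : z.im / 2 ≤ ‖w - t‖ := by
      calc z.im / 2 ≤ (w - t).im := by simpa using hw.le
        _ ≤ ‖w - t‖ := (le_abs_self _).trans (Complex.abs_im_le_norm _)
    rw [norm_neg, norm_div, Complex.norm_real, norm_pow]
    gcongr
  · exact hf.norm.div_const _
  · refine ae_of_all _ fun t w hw => ?_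
    have hw : z.im / 2 < w.im := hw
    have hne : w - t ≠ 0 := by
      intro h
      have := congrArg Complex.im h
      simp at this; linarith
    have := (((hasDerivAt_id w).sub_const (t : ℂ)).inv hne).const_mul (f t : ℂ)
    refine this.congr_deriv ?_
    simp; ring

lemma cauchyIntegral_re {f : ℝ → ℝ} (hf : Integrable f) {y : ℝ} (hy : 0 < y) (x : ℝ) :
    (cauchyIntegral f (x + y * Complex.I)).re = poissonIntegral y f x := by
  have hi := integrable_div_sub hf (z := x + y * Complex.I) (by simpa)
  have : ∀ t : ℝ, y / ((x - t) ^ 2 + y ^ 2) * f t =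
      -((f t : ℂ) / (x + y * Complex.I - t)).im := fun t => by
    rw [Complex.div_im]; simp [Complex.normSq_apply]; ring
  unfold cauchyIntegral poissonIntegral
  simp_rw [this, integral_neg]
  rw [show ∫ t : ℝ, ((f t : ℂ) / (x + y * Complex.I - t)).im = _ from integral_im hi]
  simp [Complex.mul_re, Complex.div_im]

lemma cauchyIntegral_im {f : ℝ → ℝ} (hf : Integrable f) {y : ℝ} (hy : 0 < y) (x : ℝ) :
    (cauchyIntegral f (x + y * Complex.I)).im = conjPoissonIntegral y f x := by
  have hi := integrable_div_sub hf (z := x + y * Complex.I) (by simpa)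
  have : ∀ t : ℝ, ((x - t) / ((x - t) ^ 2 + y ^ 2)) • f t =
      ((f t : ℂ) / (x + y * Complex.I - t)).re := fun t => by
    rw [Complex.div_re]; simp [Complex.normSq_apply]; ring
  unfold cauchyIntegral conjPoissonIntegral
  simp_rw [this]
  rw [show ∫ t : ℝ, ((f t : ℂ) / (x + y * Complex.I - t)).re = _ from integral_re hi]
  simp [Complex.mul_im, Complex.div_im]

lemma norm_cauchyIntegral_le {f : ℝ → ℝ} (hf : Integrable f) {R : ℝ}
    (hR : ∀ t, R < |t| → f t = 0) {z : ℂ} (hzR : 2 * R ≤ ‖z‖) (hz0 : z ≠ 0) :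
    ‖cauchyIntegral f z‖ ≤ (∫ t, |f t|) / ‖z‖ := by
  have hn : 0 < ‖z‖ := norm_pos_iff.2 hz0
  have h1 : ‖∫ t : ℝ, (f t : ℂ) / (z - t)‖ ≤ ∫ t, |f t| * (2 / ‖z‖) := by
    refine norm_integral_le_of_norm_le (hf.abs.mul_const _) (ae_of_all _ fun t => ?_)
    rw [norm_div, Complex.norm_real, Real.norm_eq_abs, div_eq_mul_inv]
    by_cases ht : R < |t|
    · simp [hR t ht]
    · have : ‖z‖ / 2 ≤ ‖z - t‖ := by
        have := norm_sub_norm_le z t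
        rw [Complex.norm_real, Real.norm_eq_abs] at this
        linarith
      gcongr
      rw [← inv_div]
      exact inv_anti₀ (by positivity) this
  rw [integral_mul_const] at h1
  have hI : 0 ≤ ∫ t, |f t| := integral_nonneg fun t => abs_nonneg _
  rw [cauchyIntegral, norm_mul, norm_div, Complex.norm_I, Complex.norm_real, Real.norm_eq_abs,
    abs_of_pos Real.pi_pos]
  calc 1 / Real.pi * ‖∫ t : ℝ, (f t : ℂ) / (z - t)‖
      ≤ 1 / 2 * ((∫ t, |f t|) * (2 / ‖z‖)) := by
        gcongr
        exact Real.two_le_pi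
    _ = _ := by ring

lemma poissonIntegral_pos {f : ℝ → ℝ} (hf : Integrable f) (hf0 : 0 ≤ f) (hne : ¬ f =ᵐ[volume] 0)
    {y : ℝ} (hy : 0 < y) (x : ℝ) : 0 < poissonIntegral y f x := by
  refine mul_pos (by positivity) ?_
  have hi : Integrable fun t => y / ((x - t) ^ 2 + y ^ 2) * f t := by
    refine hf.bdd_mul (c := 1 / y) (Measurable.aestronglyMeasurable (by fun_prop)) (ae_of_all _ fun t => ?_)
    rw [Real.norm_eq_abs, abs_of_nonneg (by positivity), div_le_div_iff₀ (by positivity) hy]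
    nlinarith [sq_nonneg (x - t)]
  have hnn : 0 ≤ fun t => y / ((x - t) ^ 2 + y ^ 2) * f t := fun t =>
    mul_nonneg (by positivity) (hf0 t)
  refine (integral_nonneg hnn).lt_of_ne fun h => hne ?_
  have := (integral_eq_zero_iff_of_nonneg hnn hi).1 h.symm
  filter_upwards [this] with t ht
  have hpos : 0 < y / ((x - t) ^ 2 + y ^ 2) := by positivity
  simpa [hpos.ne'] using ht

/-- The Poisson integral is a contraction of `L^p`. -/
lemma lintegral_poissonIntegral_le {f : ℝ → ℝ} (hf : AEStronglyMeasurable f volume) {p : ℝ}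
    (hp : 1 ≤ p) {y : ℝ} (hy : 0 < y) :
    ∫⁻ x, ‖poissonIntegral y f x‖ₑ ^ p ≤ ∫⁻ t, ‖f t‖ₑ ^ p := by
  lift y to NNReal using hy.le
  have hy' : y ≠ 0 := by rintro rfl; simp at hy
  have hp0 : 0 < p := by linarith
  let k (x t : ℝ) : ENNReal := ProbabilityTheory.cauchyPDF x y t
  have hk (x t : ℝ) : k x t = ENNReal.ofReal (Real.pi⁻¹ * (y / ((x - t) ^ 2 + y ^ 2))) := by
    simp only [k, ProbabilityTheory.cauchyPDF_def, ProbabilityTheory.cauchyPDFReal_def]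
    congr 1; ring
  have hk_symm (x t : ℝ) : k x t = k t x := by
    rw [hk, hk, show (x - t) ^ 2 = (t - x) ^ 2 by ring]
  have hkm : Measurable (Function.uncurry k) := by
    have : Function.uncurry k = fun q : ℝ × ℝ =>
        ENNReal.ofReal (Real.pi⁻¹ * (y / ((q.1 - q.2) ^ 2 + y ^ 2))) := by
      ext q; exact hk _ _
    rw [this]; fun_prop
  have hpt (x : ℝ) : ‖poissonIntegral y f x‖ₑ ^ p ≤ ∫⁻ t, k x t * ‖f t‖ₑ ^ p := by
    have hμ : ProbabilityTheory.cauchyMeasure x y = volume.withDensity (k x) :=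
      ProbabilityTheory.cauchyMeasure_of_scale_ne_zero x hy'
    have hac : ProbabilityTheory.cauchyMeasure x y ≪ volume :=
      hμ ▸ withDensity_absolutelyContinuous _ _
    have h1 : ‖poissonIntegral y f x‖ₑ ≤ ∫⁻ t, k x t * ‖f t‖ₑ := by
      rw [poissonIntegral, ← integral_const_mul]
      refine (enorm_integral_le_lintegral_enorm _).trans (lintegral_mono fun t => ?_)
      rw [← mul_assoc, enorm_mul, hk, Real.enorm_of_nonneg (by positivity)]
    have hkx : Measurable (k x) := ProbabilityTheory.measurable_cauchyPDF x y
    have h2 : ∀ g : ℝ → ENNReal, AEMeasurable g volume →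
        ∫⁻ t, k x t * g t = ∫⁻ t, g t ∂(ProbabilityTheory.cauchyMeasure x y) := fun g hg => by
      rw [hμ, lintegral_withDensity_eq_lintegral_mul₀ hkx.aemeasurable hg]; rfl
    rw [h2 _ hf.enorm] at h1
    rw [h2 _ (hf.enorm.pow_const p)]
    have h3 := eLpNorm_le_eLpNorm_of_exponent_le (p := 1) (q := ENNReal.ofReal p)
      (by simpa using hp) (hf.mono_ac hac)
    rw [eLpNorm_one_eq_lintegral_enorm, eLpNorm_eq_lintegral_rpow_enorm_toReal (by simpa) (by simp),
      ENNReal.toReal_ofReal hp0.le] at h3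
    calc _ ≤ ((∫⁻ t, ‖f t‖ₑ ^ p ∂(ProbabilityTheory.cauchyMeasure x y)) ^ (1 / p)) ^ p := by
          gcongr; exact h1.trans h3
      _ = _ := by rw [← ENNReal.rpow_mul, one_div_mul_cancel hp0.ne', ENNReal.rpow_one]
  calc ∫⁻ x, ‖poissonIntegral y f x‖ₑ ^ p ≤ ∫⁻ x, ∫⁻ t, k x t * ‖f t‖ₑ ^ p := lintegral_mono hpt
    _ = ∫⁻ t, ∫⁻ x, k x t * ‖f t‖ₑ ^ p := by
        refine lintegral_lintegral_swap ?_
        exact hkm.aemeasurable.mul ((hf.comp_snd).enorm.pow_const p)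
    _ = ∫⁻ t, ‖f t‖ₑ ^ p := by
        refine lintegral_congr fun t => ?_
        simp_rw [hk_symm _ t]
        rw [lintegral_mul_const _ (ProbabilityTheory.measurable_cauchyPDF t y),
          ProbabilityTheory.lintegral_cauchyPDF_eq_one t hy', one_mul]

lemma continuous_cauchyIntegral {f : ℝ → ℝ} (hf : Integrable f) {y : ℝ} (hy : 0 < y) :
    Continuous fun x : ℝ => cauchyIntegral f (x + y * Complex.I) := by
  refine continuous_iff_continuousAt.2 fun x => ?_
  have h := (differentiableAt_cauchyIntegral hf (z := x + y * Complex.I) (by simpa)).continuousAt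
  exact ContinuousAt.comp (f := fun x : ℝ => (x : ℂ) + y * Complex.I) h (by fun_prop)

lemma continuous_conjPoissonIntegral {f : ℝ → ℝ} (hf : Integrable f) {y : ℝ} (hy : 0 < y) :
    Continuous (conjPoissonIntegral y f) :=
  (Complex.continuous_im.comp (continuous_cauchyIntegral hf hy)).congr
    fun x => cauchyIntegral_im hf hy x

/-- Cauchy's theorem on a square with side comparable to `T`: the `p`-th power of the Cauchy
integral has almost vanishing integral over the segment of half-length `T`. -/
lemma norm_integral_cauchyIntegral_cpow_le {f : ℝ → ℝ} (hf : Integrable f) {R : ℝ}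
    (hR : ∀ t, R < |t| → f t = 0) (hf0 : 0 ≤ f) (hne : ¬ f =ᵐ[volume] 0) {p : ℝ} (hp : 1 < p)
    {y : ℝ} (hy : 0 < y) {T : ℝ} (hT : 0 < T) (hRT : 2 * R ≤ T) :
    ‖∫ x in (-T)..T, cauchyIntegral f (x + y * Complex.I) ^ (p : ℂ)‖ ≤
      4 * (∫ t, |f t|) ^ p * T ^ (1 - p) := by
  set K := ∫ t, |f t| with hK
  have hK0 : 0 ≤ K := integral_nonneg fun t => abs_nonneg _
  have hre {z : ℂ} (hz : 0 < z.im) : 0 < (cauchyIntegral f z).re := by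
    have := poissonIntegral_pos hf hf0 hne hz z.re
    rwa [← cauchyIntegral_re hf hz, Complex.re_add_im] at this
  have hbound {z : ℂ} (hz : 0 < z.im) (hzT : T ≤ ‖z‖) :
      ‖cauchyIntegral f z ^ (p : ℂ)‖ ≤ (K / T) ^ p := by
    rw [Complex.norm_cpow_real]
    refine Real.rpow_le_rpow (norm_nonneg _) ?_ (by linarith)
    refine (norm_cauchyIntegral_le hf hR (by linarith) ?_).trans ?_
    · rintro rfl; simp at hz
    · gcongr
  have hrect := Complex.integral_boundary_rect_eq_zero_of_differentiableOn
    (fun z => cauchyIntegral f z ^ (p : ℂ)) ((-T : ℝ) + y * Complex.I)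
    ((T : ℝ) + ((y + T : ℝ) : ℂ) * Complex.I) (fun z hz => by
      have hzim : 0 < z.im := by
        have := (Complex.mem_reProdIm.1 hz).2
        simp at this
        rw [Set.uIcc_of_le (by linarith)] at this
        exact hy.trans_le this.1
      exact ((differentiableAt_cauchyIntegral hf hzim).cpow_const
        (Or.inl (hre hzim))).differentiableWithinAt)
  simp only [Complex.add_re, Complex.ofReal_re, Complex.mul_re, Complex.I_re, mul_zero,
    Complex.ofReal_im, Complex.I_im, mul_one, sub_self, add_zero, Complex.add_im, Complex.mul_im,
    zero_add] at hrect
  have htop : ‖∫ x in (-T)..T, cauchyIntegral f (x + ((y + T : ℝ) : ℂ) * Complex.I) ^ (p : ℂ)‖ ≤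
      (K / T) ^ p * |T - -T| := by
    refine intervalIntegral.norm_integral_le_of_norm_le_const fun x _ => hbound ?_ ?_
    · simp; linarith
    · refine le_trans ?_ (Complex.abs_im_le_norm _)
      simp; exact le_trans (by linarith) (le_abs_self _)
  have hside (s : ℝ) (hs : |s| = T) : ‖∫ v in y..(y + T),
      cauchyIntegral f ((s : ℂ) + v * Complex.I) ^ (p : ℂ)‖ ≤ (K / T) ^ p * |y + T - y| := by
    refine intervalIntegral.norm_integral_le_of_norm_le_const fun v hv => hbound ?_ ?_
    · rw [Set.uIoc_of_le (by linarith)] at hv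
      simpa using hy.trans hv.1
    · refine le_trans ?_ (Complex.abs_re_le_norm _)
      simp [hs]
  have hl := hside (-T) (by simp [abs_of_pos hT])
  have hr := hside T (abs_of_pos hT)
  rw [show |y + T - y| = T by simp [abs_of_pos hT]] at hl hr
  rw [show |T - -T| = 2 * T by rw [abs_of_pos] <;> linarith] at htop
  have hpow : (K / T) ^ p * T = K ^ p * T ^ (1 - p) := by
    rw [Real.div_rpow hK0 hT.le, Real.rpow_sub hT, Real.rpow_one]; ring
  have heq : (∫ x in (-T)..T, cauchyIntegral f (x + y * Complex.I) ^ (p : ℂ)) =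
      (∫ x in (-T)..T, cauchyIntegral f (x + ((y + T : ℝ) : ℂ) * Complex.I) ^ (p : ℂ)) -
      Complex.I • (∫ v in y..(y + T), cauchyIntegral f ((T : ℂ) + v * Complex.I) ^ (p : ℂ)) +
      Complex.I • (∫ v in y..(y + T),
        cauchyIntegral f (((-T : ℝ) : ℂ) + v * Complex.I) ^ (p : ℂ)) := by
    linear_combination hrect
  rw [heq]
  grw [norm_add_le, norm_sub_le]
  rw [norm_smul, norm_smul, Complex.norm_I, one_mul, one_mul]
  linarith

lemma lintegral_conjPoissonIntegral_le_of_nonneg {p : ℝ} (hp : 1 < p) (hp2 : p ≤ 2) :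
    ∃ A : NNReal, ∀ (f : ℝ → ℝ) (y : ℝ), Integrable f → HasCompactSupport f → 0 ≤ f → 0 < y →
      ∫⁻ x, ‖conjPoissonIntegral y f x‖ₑ ^ p ≤ A * ∫⁻ t, ‖f t‖ₑ ^ p := by
  obtain ⟨A, B, hA, hB, hAB⟩ := exists_rpow_norm_le_re_cpow hp hp2
  refine ⟨A.toNNReal, fun f y hf hfc hf0 hy => ?_⟩
  have hp0 : 0 < p := by linarith
  by_cases hne : f =ᵐ[volume] 0
  · have : ∀ x, conjPoissonIntegral y f x = 0 := fun x => by
      rw [conjPoissonIntegral, integral_eq_zero_of_ae, smul_zero]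
      filter_upwards [hne] with t ht
      simp [ht]
    simp [this, hp0]
  obtain ⟨R, hR⟩ : ∃ R, ∀ t, R < |t| → f t = 0 := by
    obtain ⟨R, hR⟩ := hfc.isCompact.isBounded.subset_closedBall (0 : ℝ)
    refine ⟨R, fun t ht => image_eq_zero_of_notMem_tsupport fun h => ?_⟩
    have := hR h
    simp at this
    linarith
  set F : ℝ → ℂ := fun x => cauchyIntegral f (x + y * Complex.I) with hF
  have hFc : Continuous F := continuous_cauchyIntegral hf hy
  have hFre (x : ℝ) : (F x).re = poissonIntegral y f x := cauchyIntegral_re hf hy x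
  have hFim (x : ℝ) : (F x).im = conjPoissonIntegral y f x := cauchyIntegral_im hf hy x
  have hFpos (x : ℝ) : 0 < (F x).re := hFre x ▸ poissonIntegral_pos hf hf0 hne hy x
  set K := ∫ t, |f t|
  have hcov : AECover (volume : Measure ℝ) atTop fun T : ℝ => Set.Ioc (-T) T :=
    aecover_Ioc tendsto_neg_atTop_atBot tendsto_id
  have hlim := hcov.lintegral_tendsto_of_countably_generated
    (f := fun x => ‖conjPoissonIntegral y f x‖ₑ ^ p) (by
      simp_rw [← hFim]
      exact ((Complex.continuous_im.comp hFc).enorm.aemeasurable).pow_const p)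
  have hlim2 : Tendsto (fun T : ℝ => (A.toNNReal : ENNReal) * (∫⁻ t, ‖f t‖ₑ ^ p) +
      ENNReal.ofReal (B * (4 * K ^ p * T ^ (1 - p)))) atTop
      (𝓝 ((A.toNNReal : ENNReal) * (∫⁻ t, ‖f t‖ₑ ^ p) +
        ENNReal.ofReal (B * (4 * K ^ p * 0)))) := by
    refine tendsto_const_nhds.add (ENNReal.tendsto_ofReal ?_)
    refine ((?_ : Tendsto _ _ _).const_mul _).const_mul _
    have := tendsto_rpow_neg_atTop (y := p - 1) (by linarith)
    simpa using this
  rw [mul_zero, mul_zero, ENNReal.ofReal_zero, add_zero] at hlim2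
  refine le_of_tendsto_of_tendsto hlim hlim2 ?_
  filter_upwards [eventually_gt_atTop 0, eventually_ge_atTop (2 * R)] with T hT hRT
  have hpc : Continuous fun x => (F x) ^ (p : ℂ) :=
    hFc.cpow continuous_const fun x => Or.inl (hFpos x)
  have hPc : Continuous fun x => (F x).re ^ p :=
    (Complex.continuous_re.comp hFc).rpow_const fun x => Or.inr hp0.le
  have hpcre : Continuous fun x => ((F x) ^ (p : ℂ)).re := Complex.continuous_re.comp hpc
  have hQc : Continuous fun x => |(F x).im| ^ p :=
    (Complex.continuous_im.comp hFc).abs.rpow_const fun x => Or.inr hp0.le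
  have hreal : ∫ x in (-T)..T, |(F x).im| ^ p ≤
      A * (∫ x in (-T)..T, (F x).re ^ p) + B * (4 * K ^ p * T ^ (1 - p)) := by
    have h1 : ∫ x in (-T)..T, |(F x).im| ^ p ≤
        ∫ x in (-T)..T, (A * (F x).re ^ p - B * ((F x) ^ (p : ℂ)).re) := by
      refine intervalIntegral.integral_mono (by linarith) (hQc.intervalIntegrable _ _)
        (Continuous.intervalIntegrable ?_ _ _) fun x => ?_
      · exact (hPc.const_mul A).sub (hpcre.const_mul B)
      · refine le_trans ?_ (hAB (F x) (hFpos x))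
        exact Real.rpow_le_rpow (abs_nonneg _) (Complex.abs_im_le_norm _) hp0.le
    rw [intervalIntegral.integral_sub ((hPc.const_mul A).intervalIntegrable _ _)
      ((hpcre.const_mul B).intervalIntegrable _ _),
      intervalIntegral.integral_const_mul, intervalIntegral.integral_const_mul] at h1
    have h2 := norm_integral_cauchyIntegral_cpow_le hf hR hf0 hne hp hy hT hRT
    have h3 : ∫ x in (-T)..T, ((F x) ^ (p : ℂ)).re = (∫ x in (-T)..T, (F x) ^ (p : ℂ)).re :=
      Complex.reCLM.intervalIntegral_comp_comm (hpc.intervalIntegrable _ _)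
    have h4 : -(∫ x in (-T)..T, ((F x) ^ (p : ℂ)).re) ≤ 4 * K ^ p * T ^ (1 - p) := by
      rw [h3]
      exact (neg_le_abs _).trans ((Complex.abs_re_le_norm _).trans h2)
    nlinarith [mul_le_mul_of_nonneg_left h4 hB]
  have hle : -T ≤ T := by linarith
  rw [intervalIntegral.integral_of_le hle, intervalIntegral.integral_of_le hle] at hreal
  have hofReal {g : ℝ → ℝ} (hg : Continuous g) (hg0 : 0 ≤ g) :
      ENNReal.ofReal (∫ x in Set.Ioc (-T) T, g x) = ∫⁻ x in Set.Ioc (-T) T, ENNReal.ofReal (g x) :=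
    ofReal_integral_eq_lintegral_ofReal (hg.integrableOn_Ioc) (ae_of_all _ hg0)
  have h5 := ENNReal.ofReal_le_ofReal hreal
  have h6 : 0 ≤ ∫ x in Set.Ioc (-T) T, (F x).re ^ p :=
    integral_nonneg fun x => Real.rpow_nonneg (hFpos x).le _
  have hK0 : 0 ≤ K := integral_nonneg fun t => abs_nonneg _
  rw [ENNReal.ofReal_add (by positivity) (by positivity), ENNReal.ofReal_mul hA, hofReal hQc
    fun x => by positivity, hofReal hPc fun x => Real.rpow_nonneg (hFpos x).le _] at h5
  calc ∫⁻ x in Set.Ioc (-T) T, ‖conjPoissonIntegral y f x‖ₑ ^ p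
      = ∫⁻ x in Set.Ioc (-T) T, ENNReal.ofReal (|(F x).im| ^ p) := by
        refine lintegral_congr fun x => ?_
        rw [← hFim, Real.enorm_eq_ofReal_abs, ENNReal.ofReal_rpow_of_nonneg (abs_nonneg _) hp0.le]
    _ ≤ _ := h5
    _ ≤ _ := by
        gcongr ?_ + _
        refine mul_le_mul_right (le_trans ?_
          (lintegral_poissonIntegral_le hf.aestronglyMeasurable hp.le hy)) _
        refine le_trans (le_of_eq ?_) (setLIntegral_le_lintegral (Set.Ioc (-T) T) _)
        refine lintegral_congr fun x => ?_
        rw [← hFre, Real.enorm_of_nonneg (hFpos x).le,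
          ENNReal.ofReal_rpow_of_nonneg (hFpos x).le hp0.le]

section

variable {E : Type*} [NormedAddCommGroup E] [NormedSpace ℝ E]

lemma abs_div_sq_add_sq_le {y : ℝ} (hy : 0 < y) (s : ℝ) : |s / (s ^ 2 + y ^ 2)| ≤ 1 / y := by
  rw [abs_div, abs_of_pos (by positivity : 0 < s ^ 2 + y ^ 2), div_le_div_iff₀ (by positivity) hy]
  nlinarith [sq_nonneg (|s| - y), sq_abs s, abs_nonneg s]

lemma integrable_conjPoisson_smul {f : ℝ → E} (hf : Integrable f) {y : ℝ} (hy : 0 < y) (x : ℝ) :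
    Integrable fun t => ((x - t) / ((x - t) ^ 2 + y ^ 2)) • f t :=
  hf.bdd_smul (1 / y) (Measurable.aestronglyMeasurable (by fun_prop))
    (ae_of_all _ fun t => abs_div_sq_add_sq_le hy (x - t))

lemma conjPoissonIntegral_sub {f g : ℝ → E} (hf : Integrable f) (hg : Integrable g) {y : ℝ}
    (hy : 0 < y) :
    conjPoissonIntegral y (f - g) = conjPoissonIntegral y f - conjPoissonIntegral y g := by
  ext x
  simp only [conjPoissonIntegral, Pi.sub_apply, smul_sub]
  rw [integral_sub (integrable_conjPoisson_smul hf hy x) (integrable_conjPoisson_smul hg hy x),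
    smul_sub]

end

lemma eLpNorm_conjPoissonIntegral_le_of_le_two {p : ℝ} (hp : 1 < p) (hp2 : p ≤ 2) :
    ∃ C : NNReal, ∀ (f : ℝ → ℝ) (y : ℝ), Integrable f → HasCompactSupport f → 0 < y →
      eLpNorm (conjPoissonIntegral y f) (ENNReal.ofReal p) volume ≤
        C * eLpNorm f (ENNReal.ofReal p) volume := by
  obtain ⟨A, hA⟩ := lintegral_conjPoissonIntegral_le_of_nonneg hp hp2
  have hp0 : 0 < p := by linarith
  have hnonneg (f : ℝ → ℝ) (y : ℝ) (hf : Integrable f) (hfc : HasCompactSupport f) (hf0 : 0 ≤ f)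
      (hy : 0 < y) : eLpNorm (conjPoissonIntegral y f) (ENNReal.ofReal p) volume ≤
        (A ^ (1 / p) : NNReal) * eLpNorm f (ENNReal.ofReal p) volume := by
    rw [eLpNorm_eq_lintegral_rpow_enorm_toReal (by simpa) (by simp),
      eLpNorm_eq_lintegral_rpow_enorm_toReal (by simpa) (by simp), ENNReal.toReal_ofReal hp0.le,
      ENNReal.coe_rpow_of_nonneg _ (by positivity),
      ← ENNReal.mul_rpow_of_nonneg _ _ (by positivity)]
    gcongr
    exact hA f y hf hfc hf0 hy
  refine ⟨2 * A ^ (1 / p), fun f y hf hfc hy => ?_⟩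
  have hpart {f : ℝ → ℝ} (hf : Integrable f) (hfc : HasCompactSupport f) :
      eLpNorm (conjPoissonIntegral y fun t => max (f t) 0) (ENNReal.ofReal p) volume ≤
        (A ^ (1 / p) : NNReal) * eLpNorm f (ENNReal.ofReal p) volume := by
    refine (hnonneg _ y hf.pos_part (hfc.comp_left (g := fun r => max r 0) (by simp))
      (fun t => le_max_right _ _) hy).trans ?_
    gcongr
    refine eLpNorm_mono fun t => ?_
    rw [Real.norm_eq_abs, Real.norm_eq_abs, abs_of_nonneg (le_max_right _ _)]
    exact max_le (le_abs_self _) (abs_nonneg _)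
  have hsplit : f = (fun t => max (f t) 0) - fun t => max ((-f) t) 0 := by
    ext t
    simp only [Pi.sub_apply, Pi.neg_apply]
    rcases le_total 0 (f t) with h | h <;> simp [h]
  have h1 := hpart hf hfc
  have h2 := hpart hf.neg (f := -f) hfc.neg
  rw [eLpNorm_neg] at h2
  rw [hsplit, conjPoissonIntegral_sub hf.pos_part hf.neg.pos_part hy, ← hsplit]
  refine (eLpNorm_sub_le
    (continuous_conjPoissonIntegral hf.pos_part hy).aestronglyMeasurable
    (continuous_conjPoissonIntegral hf.neg.pos_part hy).aestronglyMeasurable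
    (by simpa using hp.le)).trans ?_
  calc _ ≤ _ := add_le_add h1 h2
    _ = _ := by push_cast; ring

/-- The conjugate Poisson integral is antisymmetric. -/
lemma integral_conjPoissonIntegral_mul {f g : ℝ → ℝ} (hf : Integrable f) (hg : Integrable g)
    {y : ℝ} (hy : 0 < y) :
    ∫ x, conjPoissonIntegral y f x * g x = -∫ t, f t * conjPoissonIntegral y g t := by
  have hint : Integrable (Function.uncurry fun x t : ℝ =>
      (x - t) / ((x - t) ^ 2 + y ^ 2) * (g x * f t)) (volume.prod volume) :=
    (hg.mul_prod hf).bdd_mul (c := 1 / y) (Measurable.aestronglyMeasurable (by fun_prop))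
      (ae_of_all _ fun q => abs_div_sq_add_sq_le hy (q.1 - q.2))
  have hswap := integral_integral_swap hint
  have h1 (x : ℝ) : conjPoissonIntegral y f x * g x =
      Real.pi⁻¹ * ∫ t, (x - t) / ((x - t) ^ 2 + y ^ 2) * (g x * f t) := by
    simp only [conjPoissonIntegral, smul_eq_mul]
    rw [mul_assoc, ← integral_mul_const]
    congr 2; ext t; ring
  have h2 (t : ℝ) : f t * conjPoissonIntegral y g t =
      -(Real.pi⁻¹ * ∫ x, (x - t) / ((x - t) ^ 2 + y ^ 2) * (g x * f t)) := by
    simp only [conjPoissonIntegral, smul_eq_mul]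
    rw [mul_left_comm, ← integral_const_mul, ← mul_neg, ← integral_neg]
    congr 2; ext x
    rw [show (t - x) ^ 2 = (x - t) ^ 2 by ring]
    ring
  simp_rw [h1, h2, integral_neg, neg_neg, integral_const_mul, hswap]

lemma eLpNorm_le_of_tendsto {α E : Type*} [MeasurableSpace α] {μ : Measure α}
    [NormedAddCommGroup E] {p C : ENNReal} {F : ℕ → α → E} {f : α → E}
    (hF : ∀ n, AEStronglyMeasurable (F n) μ) (hC : ∀ n, eLpNorm (F n) p μ ≤ C)
    (hlim : ∀ x, Tendsto (fun n => F n x) atTop (𝓝 (f x))) : eLpNorm f p μ ≤ C := by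
  refine (Lp.eLpNorm_lim_le_liminf_eLpNorm hF f (ae_of_all _ hlim)).trans ?_
  exact (liminf_le_liminf (Eventually.of_forall hC)).trans (liminf_const C).le

lemma tendsto_indicator_Icc_nat {E : Type*} [TopologicalSpace E] [Zero E] (f : ℝ → E) (x : ℝ) :
    Tendsto (fun n : ℕ => (Set.Icc (-n : ℝ) n).indicator f x) atTop (𝓝 (f x)) := by
  refine tendsto_const_nhds.congr' ?_
  filter_upwards [eventually_ge_atTop ⌈|x|⌉₊] with n hn
  rw [Set.indicator_of_mem]
  exact Set.mem_Icc.2 (abs_le.1 ((Nat.le_ceil _).trans (by exact_mod_cast hn)))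

lemma eLpNorm_conjPoissonIntegral_le_of_two_lt {p : ℝ} (hp : 2 < p) :
    ∃ C : NNReal, ∀ (f : ℝ → ℝ) (y : ℝ), Integrable f → HasCompactSupport f → 0 < y →
      eLpNorm (conjPoissonIntegral y f) (ENNReal.ofReal p) volume ≤
        C * eLpNorm f (ENNReal.ofReal p) volume := by
  have hp0 : 0 < p := by linarith
  set q := Real.conjExponent p with hq
  have hpq : p.HolderConjugate q := .conjExponent (by linarith)
  have hq0 : 0 < q := hpq.symm.pos
  have hq2 : q ≤ 2 := by
    rw [hq, Real.conjExponent, div_le_iff₀ (by linarith)]; linarith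
  obtain ⟨C, hC⟩ := eLpNorm_conjPoissonIntegral_le_of_le_two hpq.symm.lt hq2
  refine ⟨C, fun f y hf hfc hy => ?_⟩
  set v := conjPoissonIntegral y f with hv
  have hvc : Continuous v := continuous_conjPoissonIntegral hf hy
  refine eLpNorm_le_of_tendsto (F := fun n : ℕ => (Set.Icc (-n : ℝ) n).indicator v)
    (fun n => hvc.aestronglyMeasurable.indicator measurableSet_Icc) (fun n => ?_)
    (tendsto_indicator_Icc_nat v)
  set S := Set.Icc (-n : ℝ) n
  set g : ℝ → ℝ := S.indicator fun x => v x * |v x| ^ (p - 2) with hg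
  have hwc : Continuous fun x => v x * |v x| ^ (p - 2) :=
    hvc.mul (hvc.abs.rpow_const fun x => Or.inr (by linarith))
  have hgi : Integrable g := (integrable_indicator_iff measurableSet_Icc).2 hwc.integrableOn_Icc
  have hgc : HasCompactSupport g := HasCompactSupport.intro isCompact_Icc fun x hx =>
    Set.indicator_of_notMem hx _
  set X := eLpNorm (S.indicator v) (ENNReal.ofReal p) volume with hX
  have hXp : X ^ p = ∫⁻ x in S, ‖v x‖ₑ ^ p := by
    rw [hX, eLpNorm_indicator_eq_eLpNorm_restrict measurableSet_Icc,
      eLpNorm_eq_lintegral_rpow_enorm_toReal (by simpa) (by simp), ENNReal.toReal_ofReal hp0.le,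
      ← ENNReal.rpow_mul, one_div_mul_cancel hp0.ne', ENNReal.rpow_one]
  have hXtop : X ≠ ⊤ := by
    have : IntegrableOn (fun x => |v x| ^ p) S :=
      (hvc.abs.rpow_const fun x => Or.inr hp0.le).integrableOn_Icc
    have := this.2
    rw [hasFiniteIntegral_iff_enorm] at this
    intro h
    rw [h, ENNReal.top_rpow_of_pos hp0] at hXp
    refine this.ne (hXp.trans (lintegral_congr fun x => ?_)).symm
    rw [Real.enorm_rpow_of_nonneg (abs_nonneg _) hp0.le, Real.enorm_abs]
  have hgq : eLpNorm g (ENNReal.ofReal q) volume = X ^ (p - 1) := by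
    rw [hg, eLpNorm_indicator_eq_eLpNorm_restrict measurableSet_Icc,
      eLpNorm_eq_lintegral_rpow_enorm_toReal (by simpa) (by simp), ENNReal.toReal_ofReal hq0.le]
    have : ∀ x, ‖v x * |v x| ^ (p - 2)‖ₑ ^ q = ‖v x‖ₑ ^ p := fun x => by
      rw [enorm_mul, Real.enorm_rpow_of_nonneg (abs_nonneg _) (by linarith), Real.enorm_abs]
      nth_rw 1 [← ENNReal.rpow_one ‖v x‖ₑ]
      rw [← ENNReal.rpow_add_of_nonneg _ _ (by norm_num) (by linarith), ← ENNReal.rpow_mul]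
      congr 1
      rw [show 1 + (p - 2) = p - 1 by ring]
      exact hpq.sub_one_mul_conj
    rw [lintegral_congr this, ← hXp, ← ENNReal.rpow_mul]
    congr 1
    rw [mul_one_div]
    exact hpq.div_conj_eq_sub_one
  have hdual : X ^ p ≤ eLpNorm f (ENNReal.ofReal p) volume * (C * X ^ (p - 1)) := by
    have h1 : X ^ p = ‖∫ x, v x * g x‖ₑ := by
      have hvg : (fun x => v x * g x) = S.indicator fun x => |v x| ^ p := by
        ext x
        by_cases hx : x ∈ S
        · simp only [hg, Set.indicator_of_mem hx]
          by_cases h0 : v x = 0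
          · simp [h0, hp0.ne']
          · rw [← mul_assoc, ← abs_mul_abs_self, ← sq, ← Real.rpow_natCast,
              ← Real.rpow_add (abs_pos.2 h0)]
            congr 1; push_cast; ring
        · simp [hg, hx]
      rw [hvg, integral_indicator measurableSet_Icc, hXp,
        Real.enorm_of_nonneg (integral_nonneg fun x => by positivity),
        ofReal_integral_eq_lintegral_ofReal
          (hvc.abs.rpow_const fun x => Or.inr hp0.le).integrableOn_Icc
          (ae_of_all _ fun x => by positivity)]
      refine lintegral_congr fun x => ?_
      rw [Real.enorm_eq_ofReal_abs, ENNReal.ofReal_rpow_of_nonneg (abs_nonneg _) hp0.le]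
    rw [h1, hv, integral_conjPoissonIntegral_mul hf hgi hy, enorm_neg]
    refine (enorm_integral_le_lintegral_enorm _).trans ?_
    simp_rw [enorm_mul]
    refine (ENNReal.lintegral_mul_le_Lp_mul_Lq volume hpq hf.aestronglyMeasurable.enorm
      (continuous_conjPoissonIntegral hgi hy).aestronglyMeasurable.enorm).trans ?_
    rw [← hgq]
    refine mul_le_mul' ?_ (le_trans ?_ (hC g y hgi hgc hy))
    · rw [eLpNorm_eq_lintegral_rpow_enorm_toReal (by simpa) (by simp), ENNReal.toReal_ofReal hp0.le]
    · rw [eLpNorm_eq_lintegral_rpow_enorm_toReal (by simpa) (by simp), ENNReal.toReal_ofReal hq0.le]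
  by_cases hX0 : X = 0
  · simp [hX0]
  have hpos : X ^ (p - 1) ≠ 0 := by
    simp [ENNReal.rpow_eq_zero_iff, hX0, hXtop]
  have htop : X ^ (p - 1) ≠ ⊤ := ENNReal.rpow_ne_top_of_nonneg (by linarith) hXtop
  refine (ENNReal.mul_le_mul_iff_left hpos htop).1 ?_
  calc X * X ^ (p - 1) = X ^ p := by
        nth_rw 1 [← ENNReal.rpow_one X]
        rw [← ENNReal.rpow_add _ _ hX0 hXtop]
        congr 1; ring
    _ ≤ _ := hdual
    _ = _ := by ring

lemma eLpNorm_conjPoissonIntegral_le {p : ℝ} (hp : 1 < p) :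
    ∃ C : NNReal, ∀ (f : ℝ → ℝ) (y : ℝ), Integrable f → 0 < y →
      eLpNorm (conjPoissonIntegral y f) (ENNReal.ofReal p) volume ≤
        C * eLpNorm f (ENNReal.ofReal p) volume := by
  obtain ⟨C, hC⟩ := (le_or_gt p 2).elim (eLpNorm_conjPoissonIntegral_le_of_le_two hp)
    eLpNorm_conjPoissonIntegral_le_of_two_lt
  refine ⟨C, fun f y hf hy => ?_⟩
  have hfn (n : ℕ) : Integrable ((Set.Icc (-n : ℝ) n).indicator f) := hf.indicator measurableSet_Icc
  refine eLpNorm_le_of_tendsto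
    (F := fun n : ℕ => conjPoissonIntegral y ((Set.Icc (-n : ℝ) n).indicator f))
    (fun n => (continuous_conjPoissonIntegral (hfn n) hy).aestronglyMeasurable) (fun n => ?_)
    fun x => ?_
  · refine (hC _ y (hfn n) (HasCompactSupport.intro isCompact_Icc fun x hx =>
      Set.indicator_of_notMem hx _) hy).trans ?_
    gcongr
    exact eLpNorm_indicator_le f
  · refine Tendsto.const_smul ?_ _
    have hcov : AECover (volume : Measure ℝ) atTop fun n : ℕ => Set.Icc (-n : ℝ) n :=
      aecover_Icc (tendsto_neg_atTop_atBot.comp tendsto_natCast_atTop_atTop)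
        tendsto_natCast_atTop_atTop
    have := hcov.integral_tendsto_of_countably_generated (integrable_conjPoisson_smul hf hy x)
    simpa only [← integral_indicator measurableSet_Icc, Set.indicator_smul] using this

lemma eLpNorm_conjPoissonIntegral_complex_le {p : ℝ} (hp : 1 < p) :
    ∃ C : NNReal, ∀ (f : ℝ → ℂ) (y : ℝ), Integrable f → 0 < y →
      AEStronglyMeasurable (conjPoissonIntegral y f) volume ∧
      eLpNorm (conjPoissonIntegral y f) (ENNReal.ofReal p) volume ≤
        C * eLpNorm f (ENNReal.ofReal p) volume := by
  obtain ⟨C, hC⟩ := eLpNorm_conjPoissonIntegral_le hp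
  refine ⟨2 * C, fun f y hf hy => ?_⟩
  set u := conjPoissonIntegral y fun t => (f t).re
  set w := conjPoissonIntegral y fun t => (f t).im
  have hu : Continuous u := continuous_conjPoissonIntegral hf.re hy
  have hw : Continuous w := continuous_conjPoissonIntegral hf.im hy
  have heq : conjPoissonIntegral y f = (fun x => (u x : ℂ)) + fun x => (w x : ℂ) * Complex.I := by
    ext x
    have hi := integrable_conjPoisson_smul hf hy x
    have hre := integral_re hi
    have him := integral_im hi
    apply Complex.ext
    · have : (conjPoissonIntegral y f x).re = u x := by
        simp only [RCLike.re_eq_complex_re, Complex.smul_re] at hre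
        simp only [conjPoissonIntegral, u, Complex.smul_re, hre]
      simp [this]
    · have : (conjPoissonIntegral y f x).im = w x := by
        simp only [RCLike.im_eq_complex_im, Complex.smul_im] at him
        simp only [conjPoissonIntegral, w, Complex.smul_im, him]
      simp [this]
  rw [heq]
  have hu' : AEStronglyMeasurable (fun x => (u x : ℂ)) volume :=
    (Complex.continuous_ofReal.comp hu).aestronglyMeasurable
  have hw' : AEStronglyMeasurable (fun x => (w x : ℂ) * Complex.I) volume :=
    ((Complex.continuous_ofReal.comp hw).mul continuous_const).aestronglyMeasurable
  refine ⟨hu'.add hw', (eLpNorm_add_le hu' hw' (by simpa using hp.le)).trans ?_⟩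
  rw [eLpNorm_congr_norm_ae (f := fun x => (u x : ℂ)) (g := u) (ae_of_all _ fun x => by simp),
    eLpNorm_congr_norm_ae (f := fun x => (w x : ℂ) * Complex.I) (g := w)
      (ae_of_all _ fun x => by simp)]
  calc _ ≤ C * eLpNorm f (ENNReal.ofReal p) volume + C * eLpNorm f (ENNReal.ofReal p) volume := by
        gcongr
        · refine (hC _ y hf.re hy).trans ?_
          gcongr
          exact eLpNorm_mono fun t => Complex.abs_re_le_norm _
        · refine (hC _ y hf.im hy).trans ?_
          gcongr
          exact eLpNorm_mono fun t => Complex.abs_im_le_norm _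
    _ = _ := by push_cast; ring

lemma SchwartzMap.exists_lipschitzWith (ψ : SchwartzMap ℝ ℂ) :
    ∃ K : NNReal, LipschitzWith K ψ := by
  obtain ⟨K, hK⟩ := ψ.decay 0 1
  refine ⟨K.toNNReal, lipschitzWith_of_nnnorm_fderiv_le ψ.differentiable fun x => ?_⟩
  have := hK.2 x
  rw [pow_zero, one_mul, norm_iteratedFDeriv_one] at this
  rw [← NNReal.coe_le_coe, Real.coe_toNNReal _ hK.1.le]
  exact this

lemma SchwartzMap.integrable_inv_smul_sub (ψ : SchwartzMap ℝ ℂ) (x : ℝ) :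
    Integrable fun s : ℝ => s⁻¹ • (ψ (x - s) - ψ (x + s)) := by
  obtain ⟨K, hK⟩ := ψ.exists_lipschitzWith
  have hm : AEStronglyMeasurable (fun s : ℝ => s⁻¹ • (ψ (x - s) - ψ (x + s))) volume := by
    have := ψ.continuous
    exact measurable_inv.aestronglyMeasurable.smul
      (Continuous.aestronglyMeasurable (by fun_prop))
  have h1 : Integrable fun s => ‖ψ (x - s)‖ := (ψ.integrable.comp_sub_left x).norm
  have h2 : Integrable fun s => ‖ψ (x + s)‖ := (ψ.integrable.comp_add_left x).norm
  have h3 : Integrable ((Set.Icc (-1 : ℝ) 1).indicator fun _ => 2 * (K : ℝ)) :=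
    (integrable_indicator_iff measurableSet_Icc).2 continuousOn_const.integrableOn_Icc
  refine ((h3.add h1).add h2).mono' hm (ae_of_all _ fun s => ?_)
  simp only [Pi.add_apply]
  rw [norm_smul, norm_inv, Real.norm_eq_abs]
  by_cases hs : s ∈ Set.Icc (-1 : ℝ) 1
  · rw [Set.indicator_of_mem hs]
    have h4 : ‖ψ (x - s) - ψ (x + s)‖ ≤ K * (2 * |s|) := by
      refine (hK.norm_sub_le _ _).trans (le_of_eq ?_)
      rw [show x - s - (x + s) = -(2 * s) by ring, norm_neg, Real.norm_eq_abs, abs_mul, abs_two]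
    have h5 : |s|⁻¹ * ‖ψ (x - s) - ψ (x + s)‖ ≤ 2 * K := by
      rcases eq_or_ne s 0 with rfl | h0
      · simp
      · rw [inv_mul_le_iff₀ (abs_pos.2 h0)]
        linarith
    linarith [norm_nonneg (ψ (x - s)), norm_nonneg (ψ (x + s))]
  · rw [Set.indicator_of_notMem hs, zero_add]
    have h4 : 1 ≤ |s| := by
      by_contra! h
      exact hs (abs_le.1 h.le)
    calc |s|⁻¹ * ‖ψ (x - s) - ψ (x + s)‖ ≤ 1 * ‖ψ (x - s) - ψ (x + s)‖ := by
          gcongr; exact inv_le_one_of_one_le₀ h4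
      _ ≤ _ := by rw [one_mul]; exact norm_sub_le _ _

lemma SchwartzMap.integral_odd_smul_comp_sub (ψ : SchwartzMap ℝ ℂ) (x : ℝ) {m : ℝ → ℝ}
    (hm : Measurable m) {c : ℝ} (hc : ∀ s, |m s| ≤ c) (hodd : ∀ s, m (-s) = -m s) :
    ∫ s, m s • ψ (x - s) = (1 / 2 : ℝ) • ∫ s, m s • (ψ (x - s) - ψ (x + s)) := by
  have h1 : Integrable fun s => m s • ψ (x - s) :=
    (ψ.integrable.comp_sub_left x).bdd_smul c hm.aestronglyMeasurable (ae_of_all _ hc)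
  have h2 : Integrable fun s => m s • ψ (x + s) :=
    (ψ.integrable.comp_add_left x).bdd_smul c hm.aestronglyMeasurable (ae_of_all _ hc)
  have h3 : ∫ s, m s • ψ (x + s) = -∫ s, m s • ψ (x - s) := by
    rw [← integral_neg_eq_self, ← integral_neg]
    simp [hodd, sub_eq_add_neg]
  simp_rw [smul_sub]
  rw [integral_sub h1 h2, h3, sub_neg_eq_add, ← two_smul ℝ, smul_smul]
  norm_num

/-- Odd truncations of `1 / s` dominated by `1 / |s|` all converge, against a Schwartz function, to
the same symmetrised integral. -/
lemma SchwartzMap.tendsto_integral_odd_smul {ι : Type*} {l : Filter ι} [l.IsCountablyGenerated]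
    (ψ : SchwartzMap ℝ ℂ) (x : ℝ) {m : ι → ℝ → ℝ} (hm : ∀ᶠ i in l, Measurable (m i))
    (hbdd : ∀ᶠ i in l, ∃ c, ∀ s, |m i s| ≤ c) (hodd : ∀ᶠ i in l, ∀ s, m i (-s) = -m i s)
    (hle : ∀ᶠ i in l, ∀ s, |m i s| ≤ |s|⁻¹)
    (hlim : ∀ s ≠ 0, Tendsto (fun i => m i s) l (𝓝 s⁻¹)) :
    Tendsto (fun i => ∫ s, m i s • ψ (x - s)) l
      (𝓝 ((1 / 2 : ℝ) • ∫ s : ℝ, s⁻¹ • (ψ (x - s) - ψ (x + s)))) := by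
  have hcont := ψ.continuous
  have key : Tendsto (fun i => ∫ s, m i s • (ψ (x - s) - ψ (x + s))) l
      (𝓝 (∫ s : ℝ, s⁻¹ • (ψ (x - s) - ψ (x + s)))) := by
    refine tendsto_integral_filter_of_dominated_convergence
      (fun s => ‖s⁻¹ • (ψ (x - s) - ψ (x + s))‖) ?_ ?_ (ψ.integrable_inv_smul_sub x).norm ?_
    · filter_upwards [hm] with i hi
      exact hi.aestronglyMeasurable.smul (Continuous.aestronglyMeasurable (by fun_prop))
    · filter_upwards [hle] with i hi
      refine ae_of_all _ fun s => ?_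
      rw [norm_smul, norm_smul, norm_inv]
      gcongr
      exact hi s
    · filter_upwards [compl_mem_ae_iff.2 (measure_singleton (0 : ℝ))] with s hs
      exact (hlim s hs).smul_const _
  refine (key.const_smul (1 / 2 : ℝ)).congr' ?_
  filter_upwards [hm, hbdd, hodd] with i h1 ⟨c, h2⟩ h3
  exact (ψ.integral_odd_smul_comp_sub x h1 h2 h3).symm

lemma SchwartzMap.tendsto_truncated_hilbert (ψ : SchwartzMap ℝ ℂ) (x : ℝ) :
    Tendsto
      (fun ε : ℝ => (Real.pi : ℂ)⁻¹ * ∫ y in {y : ℝ | ε ≤ |y|}, ψ (x - y) / (y : ℂ))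
      (𝓝[>] (0 : ℝ))
      (𝓝 (Real.pi⁻¹ • (1 / 2 : ℝ) • ∫ s : ℝ, s⁻¹ • (ψ (x - s) - ψ (x + s)))) := by
  have hS (ε : ℝ) : MeasurableSet {y : ℝ | ε ≤ |y|} :=
    measurableSet_le measurable_const measurable_id.abs
  have key := ψ.tendsto_integral_odd_smul x (l := 𝓝[>] (0 : ℝ))
    (m := fun ε => {y : ℝ | ε ≤ |y|}.indicator fun s => s⁻¹) ?_ ?_ ?_ ?_ ?_
  · refine (key.const_smul Real.pi⁻¹).congr fun ε => ?_
    rw [← integral_indicator (hS ε), Complex.real_smul, Complex.ofReal_inv]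
    congr 2
    ext s
    by_cases hs : s ∈ {y : ℝ | ε ≤ |y|}
    · simp only [Set.indicator_of_mem hs, Complex.real_smul, Complex.ofReal_inv]
      rw [div_eq_inv_mul]
    · simp only [Set.indicator_of_notMem hs, zero_smul]
  · exact Eventually.of_forall fun ε => measurable_inv.indicator (hS ε)
  · filter_upwards [self_mem_nhdsWithin] with ε hε
    have hε : 0 < ε := hε
    refine ⟨ε⁻¹, fun s => ?_⟩
    by_cases hs : s ∈ {y : ℝ | ε ≤ |y|}
    · rw [Set.indicator_of_mem hs, abs_inv]
      exact inv_anti₀ hε hs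
    · rw [Set.indicator_of_notMem hs, abs_zero]
      positivity
  · refine Eventually.of_forall fun ε s => ?_
    by_cases hs : ε ≤ |s| <;> simp [Set.indicator, hs, inv_neg]
  · refine Eventually.of_forall fun ε s => ?_
    by_cases hs : ε ≤ |s| <;> simp [Set.indicator, hs, abs_inv]
  · intro s hs
    refine tendsto_const_nhds.congr' ?_
    filter_upwards [mem_nhdsWithin_of_mem_nhds (Iio_mem_nhds (abs_pos.2 hs))] with ε hε
    have hε : ε < |s| := hε
    exact (Set.indicator_of_mem (s := {y : ℝ | ε ≤ |y|}) hε.le _).symm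

lemma SchwartzMap.tendsto_conjPoissonIntegral (ψ : SchwartzMap ℝ ℂ) (x : ℝ) :
    Tendsto (fun y => conjPoissonIntegral y ψ x) (𝓝[>] (0 : ℝ))
      (𝓝 (Real.pi⁻¹ • (1 / 2 : ℝ) • ∫ s : ℝ, s⁻¹ • (ψ (x - s) - ψ (x + s)))) := by
  have key := ψ.tendsto_integral_odd_smul x (l := 𝓝[>] (0 : ℝ))
    (m := fun y s => s / (s ^ 2 + y ^ 2)) ?_ ?_ ?_ ?_ ?_
  · refine (key.const_smul Real.pi⁻¹).congr fun y => ?_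
    rw [conjPoissonIntegral, ← integral_sub_left_eq_self _ _ x]
    simp
  · exact Eventually.of_forall fun y => by fun_prop
  · filter_upwards [self_mem_nhdsWithin] with y hy
    exact ⟨1 / y, abs_div_sq_add_sq_le hy⟩
  · exact Eventually.of_forall fun y s => by rw [neg_sq, neg_div]
  · filter_upwards [self_mem_nhdsWithin] with y hy s
    have hy : 0 < y := hy
    rcases eq_or_ne s 0 with rfl | hs
    · simp
    · have hs' : 0 < |s| := abs_pos.2 hs
      rw [abs_div, abs_of_pos (by positivity : 0 < s ^ 2 + y ^ 2), div_le_iff₀ (by positivity),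
        ← sq_abs s]
      field_simp
      nlinarith
  · intro s hs
    have : ContinuousAt (fun y : ℝ => s / (s ^ 2 + y ^ 2)) 0 := by
      refine ContinuousAt.div (by fun_prop) (by fun_prop) (by simpa using hs)
    have h := this.tendsto.mono_left (nhdsWithin_le_nhds (s := Set.Ioi 0))
    convert h using 2
    field_simp
    simp

/-- **M. Riesz's theorem** on the `L^p`-boundedness of the Hilbert transform: for every
Schwartz function `ψ` the Hilbert transform
`(Hψ)(x) = (1/π) lim_{ε → 0⁺} ∫_{|y| ≥ ε} ψ(x - y)/y dy` is well-defined at every point,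
and for each `1 < p < ∞` there is a constant `A_p`, independent of `ψ`, with
`‖Hψ‖_p ≤ A_p ‖ψ‖_p`. -/
theorem hilbert_transform_Lp_bounded :
    (∀ (ψ : SchwartzMap ℝ ℂ) (x : ℝ), ∃ L : ℂ,
      Tendsto
        (fun ε : ℝ => (Real.pi : ℂ)⁻¹ * ∫ y in {y : ℝ | ε ≤ |y|}, ψ (x - y) / (y : ℂ))
        (𝓝[>] (0 : ℝ)) (𝓝 L)) ∧
    ∀ p : ℝ, 1 < p → ∃ A : ℝ, ∀ (ψ : SchwartzMap ℝ ℂ) (H : ℝ → ℂ),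
      (∀ x : ℝ, Tendsto
        (fun ε : ℝ => (Real.pi : ℂ)⁻¹ * ∫ y in {y : ℝ | ε ≤ |y|}, ψ (x - y) / (y : ℂ))
        (𝓝[>] (0 : ℝ)) (𝓝 (H x))) →
      eLpNorm H (ENNReal.ofReal p) volume ≤
        ENNReal.ofReal A * eLpNorm (⇑ψ) (ENNReal.ofReal p) volume := by
  refine ⟨fun ψ x => ⟨_, ψ.tendsto_truncated_hilbert x⟩, fun p hp => ?_⟩
  obtain ⟨C, hC⟩ := eLpNorm_conjPoissonIntegral_complex_le hp
  refine ⟨C, fun ψ H hH => ?_⟩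
  have hpos (n : ℕ) : 0 < 1 / ((n : ℝ) + 1) := Nat.one_div_pos_of_nat
  rw [ENNReal.ofReal_coe_nnreal]
  refine eLpNorm_le_of_tendsto (F := fun n : ℕ => conjPoissonIntegral (1 / ((n : ℝ) + 1)) ψ)
    (fun n => (hC ψ _ ψ.integrable (hpos n)).1) (fun n => (hC ψ _ ψ.integrable (hpos n)).2)
    fun x => ?_
  rw [tendsto_nhds_unique (hH x) (ψ.tendsto_truncated_hilbert x)]
  exact (ψ.tendsto_conjPoissonIntegral x).comp (tendsto_nhdsWithin_iff.2
    ⟨tendsto_one_div_add_atTop_nhds_zero_nat, Eventually.of_forall hpos⟩)
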